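/- Let V be a 2-dimensional vector space over a field K and let ℓ₁, ℓ₂, ℓ₃ be three pairwise distinct lines (1-dimensional subspaces) of V. For distinct indices i, j, k, let ψ_{i→k}: ℓᵢ → ℓ_k denote the linear map given by the inclusion ℓᵢ ↪ V followed by the projection V → ℓ_k with kernel ℓ_j (using the decomposition V = ℓ_k ⊕ ℓ_j). Then the composition ψ_{3→1} ∘ ψ_{2→3} ∘ ψ_{1→2} : ℓ₁ → ℓ₁ equals multiplication by −1. -/

import Mathlib

/-- In a 2-dimensional vector space `V` with three pairwise distinct lines `ℓ₁, ℓ₂, ℓ₃`,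
the composition of the three projections `ψ_{1→2}`, `ψ_{2→3}`, `ψ_{3→1}` (each given by
inclusion followed by the projection onto the target line along the remaining line)
is multiplication by `-1` on `ℓ₁`.  Each projection `pₖ : V → ℓₖ` is characterized by
restricting to the identity on `ℓₖ` and killing the remaining line. -/
theorem monodromy_around_trivalent_vertex {K V : Type*} [Field K] [AddCommGroup V]
    [Module K V] (hV : Module.finrank K V = 2)
    (ℓ₁ ℓ₂ ℓ₃ : Submodule K V)
    (h1 : Module.finrank K ℓ₁ = 1) (h2 : Module.finrank K ℓ₂ = 1)
    (h3 : Module.finrank K ℓ₃ = 1)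
    (h12 : ℓ₁ ≠ ℓ₂) (h13 : ℓ₁ ≠ ℓ₃) (h23 : ℓ₂ ≠ ℓ₃)
    -- `p₂` : projection onto `ℓ₂` with kernel `ℓ₃` (used for `ψ_{1→2}`)
    (p₂ : V →ₗ[K] ↥ℓ₂) (hp₂id : ∀ x : ℓ₂, p₂ ↑x = x) (hp₂ker : ℓ₃ ≤ LinearMap.ker p₂)
    -- `p₃` : projection onto `ℓ₃` with kernel `ℓ₁` (used for `ψ_{2→3}`)
    (p₃ : V →ₗ[K] ↥ℓ₃) (hp₃id : ∀ x : ℓ₃, p₃ ↑x = x) (hp₃ker : ℓ₁ ≤ LinearMap.ker p₃)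
    -- `p₁` : projection onto `ℓ₁` with kernel `ℓ₂` (used for `ψ_{3→1}`)
    (p₁ : V →ₗ[K] ↥ℓ₁) (hp₁id : ∀ x : ℓ₁, p₁ ↑x = x) (hp₁ker : ℓ₂ ≤ LinearMap.ker p₁) :
    ∀ x : ℓ₁, p₁ ↑(p₃ ↑(p₂ (↑x : V))) = -x := by
  intro x
  haveI : FiniteDimensional K V := Module.finite_of_finrank_pos (by omega)
  have hr : LinearMap.range p₂ = ⊤ := LinearMap.range_eq_top.2 fun y => ⟨y, hp₂id y⟩
  have hk := LinearMap.finrank_range_add_finrank_ker p₂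
  rw [hr, finrank_top, h2, hV] at hk
  have hker : ℓ₃ = LinearMap.ker p₂ := Submodule.eq_of_le_of_finrank_eq hp₂ker (by omega)
  have hc : (x : V) - (p₂ (x : V) : V) ∈ ℓ₃ := by
    rw [hker, LinearMap.mem_ker, map_sub, hp₂id, sub_self]
  have e3 := hp₃id ⟨_, hc⟩
  have hx3 : p₃ (x : V) = 0 := hp₃ker x.2
  have hx1 : p₁ (p₂ (x : V) : V) = 0 := hp₁ker (p₂ (x : V)).2
  simp only [map_sub, hx3, zero_sub] at e3
  have e4 : p₃ (p₂ (x : V) : V) = -⟨_, hc⟩ := by rw [← e3, neg_neg]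
  rw [e4]
  simp [map_sub, hx1, hp₁id]
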